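/- arXiv:2509.11757 — 5 statements merged into one kernel-verified Lean document; each statement's English description precedes it below -/
import Mathlib

section
/- Let q ≥ 2 be a power of a prime and m ≥ 1 a natural number. Suppose q^m − 1 = r1 · r2 where gcd(r1, r2) = 1 and r1, r2 > 1. Then either the multiplicative order of q modulo r1 equals m, or the multiplicative order of q modulo r2 equals m. -/
theorem aux_bound (q m r : ℕ) (hq : 2 ≤ q) (hm : 1 ≤ m) (hr : r ∣ q ^ m - 1)
    (h : orderOf (q : ZMod r) ≠ m) : r + 1 ≤ q ^ (m / 2) := by
  have key : ∀ k : ℕ, (q : ZMod r) ^ k = 1 ↔ r ∣ q ^ k - 1 := by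
    intro k
    have h1 : 1 ≤ q ^ k := Nat.one_le_pow _ _ (by omega)
    rw [← ZMod.natCast_eq_zero_iff, Nat.cast_sub h1, sub_eq_zero]
    push_cast
    rfl
  have hd : orderOf (q : ZMod r) ∣ m := orderOf_dvd_of_pow_eq_one ((key m).2 hr)
  have hk := (key _).1 (pow_orderOf_eq_one (q : ZMod r))
  obtain ⟨c, hc⟩ := hd
  generalize orderOf (q : ZMod r) = a at *
  have ha : a ≠ 0 := by rintro rfl; omega
  have hc2 : 2 ≤ c := by
    rcases c with _ | _ | c
    · omega
    · omega
    · omega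
  have ham : a ≤ m / 2 := by
    rw [Nat.le_div_iff_mul_le (by norm_num), hc]
    exact Nat.mul_le_mul_left a hc2
  have h2 : 2 ≤ q ^ a := hq.trans (Nat.le_self_pow ha q)
  have h3 := Nat.le_of_dvd (by omega) hk
  have h4 : q ^ a ≤ q ^ (m / 2) := Nat.pow_le_pow_right (by omega) ham
  omega

theorem stmt_1 (q m r1 r2 : ℕ) (hq : IsPrimePow q) (hm : 1 ≤ m)
    (hfac : q ^ m - 1 = r1 * r2) (hcop : Nat.Coprime r1 r2)
    (hr1 : 1 < r1) (hr2 : 1 < r2) :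
    orderOf (q : ZMod r1) = m ∨ orderOf (q : ZMod r2) = m := by
  by_contra! hcon
  have hq2 : 2 ≤ q := hq.one_lt
  have b1 := aux_bound q m r1 hq2 hm ⟨r2, hfac⟩ hcon.1
  have b2 := aux_bound q m r2 hq2 hm ⟨r1, by rw [hfac, mul_comm]⟩ hcon.2
  have h5 := Nat.mul_le_mul b1 b2
  have h6 : q ^ (m / 2) * q ^ (m / 2) ≤ q ^ m := by
    rw [← pow_add]
    exact Nat.pow_le_pow_right (by omega) (by omega)
  have h7 : q ^ m ≤ r1 * r2 + 1 := by omega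
  nlinarith
end

section
/- Let q ≥ 2 be a power of a prime and m ≥ 1 a natural number. Suppose q^m − 1 = r1 · r2 where gcd(r1, r2) = 1 and r1, r2 > 1. Let a be the multiplicative order of q modulo r1 and b the multiplicative order of q modulo r2. Then m < a + b. -/
theorem aux_order (q m r s : ℕ) (hq : 2 ≤ q) (hm : 1 ≤ m)
    (hfac : q ^ m - 1 = r * s) :
    2 ≤ q ^ orderOf (q : ZMod r) ∧ r ≤ q ^ orderOf (q : ZMod r) - 1 := by
  have key : ∀ k : ℕ, (q : ZMod r) ^ k = 1 ↔ r ∣ q ^ k - 1 := by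
    intro k
    have h1 : 1 ≤ q ^ k := Nat.one_le_pow _ _ (by omega)
    rw [← ZMod.natCast_eq_zero_iff, Nat.cast_sub h1]
    push_cast
    rw [sub_eq_zero]
  have hpos : 0 < orderOf (q : ZMod r) :=
    orderOf_pos_iff.mpr (isOfFinOrder_iff_pow_eq_one.mpr
      ⟨m, hm, (key m).mpr (hfac ▸ dvd_mul_right r s)⟩)
  have h2 : 2 ≤ q ^ orderOf (q : ZMod r) :=
    hq.trans (Nat.le_self_pow hpos.ne' q)
  exact ⟨h2, Nat.le_of_dvd (by omega) ((key _).mp (pow_orderOf_eq_one _))⟩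

theorem stmt_3 (q m r1 r2 : ℕ) (hq : IsPrimePow q) (hm : 1 ≤ m)
    (hfac : q ^ m - 1 = r1 * r2) (hcop : Nat.Coprime r1 r2)
    (hr1 : 1 < r1) (hr2 : 1 < r2) :
    m < orderOf (q : ZMod r1) + orderOf (q : ZMod r2) := by
  have hq2 : 2 ≤ q := hq.two_le
  obtain ⟨hA, h1⟩ := aux_order q m r1 r2 hq2 hm hfac
  obtain ⟨hB, h2⟩ := aux_order q m r2 r1 hq2 hm (by rw [hfac, mul_comm])
  by_contra hlt
  have hp := Nat.pow_le_pow_right (n := q) (by omega) (not_lt.mp hlt)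
  rw [pow_add] at hp
  have hle := Nat.mul_le_mul h1 h2
  rw [← hfac] at hle
  generalize q ^ orderOf (q : ZMod r1) = A at *
  generalize q ^ orderOf (q : ZMod r2) = B at *
  obtain ⟨x, rfl⟩ := Nat.exists_eq_add_of_le hA
  obtain ⟨y, rfl⟩ := Nat.exists_eq_add_of_le hB
  have e1 : 2 + x - 1 = x + 1 := by omega
  have e2 : 2 + y - 1 = y + 1 := by omega
  rw [e1, e2] at hle
  have : q ^ m ≤ (x + 1) * (y + 1) + 1 := by omega
  nlinarith
end

section
/- Let r and h be positive natural numbers and let x_1 < x_2 < ⋯ < x_h be natural numbers with 0 ≤ x_1 and x_h < r. Then there exists a natural number μ such that ⌈r/h⌉ − 1 ≤ (x_i + μ) mod r < r for all i = 1, …, h, and (x_j + μ) mod r = r − 1 for some j ∈ {1, …, h}. -/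
theorem stmt_4 (r h : ℕ) (hr : 0 < r) (hh : 0 < h) (x : Fin h → ℕ)
    (hmono : StrictMono x) (hlt : ∀ i, x i < r) :
    ∃ μ : ℕ,
      (∀ i, (⌈(r : ℚ) / h⌉ - 1 ≤ (((x i + μ) % r : ℕ) : ℤ)) ∧ (x i + μ) % r < r) ∧
      ∃ j, (x j + μ) % r = r - 1 := by
  have key : ∃ c : ℕ, c * h < r ∧ ⌈(r : ℚ) / h⌉ - 1 ≤ (c : ℤ) := by
    refine ⟨(r - 1) / h, ?_, ?_⟩
    · have := Nat.div_mul_le_self (r - 1) h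
      omega
    · rw [sub_le_iff_le_add, Int.ceil_le, div_le_iff₀ (by exact_mod_cast hh)]
      have h1 := Nat.div_add_mod (r - 1) h
      have h2 := Nat.mod_lt (r - 1) hh
      have : r ≤ ((r - 1) / h + 1) * h := by
        rw [add_mul, mul_comm ((r - 1) / h)]; omega
      exact_mod_cast this
  obtain ⟨c, hc, hcc⟩ := key
  have ht : ∃ t ∈ Finset.range r, t ∉ (Finset.univ : Finset (Fin h × Fin c)).image
      (fun p => (x p.1 + p.2) % r) := by
    apply Finset.exists_mem_notMem_of_card_lt_card
    refine lt_of_le_of_lt Finset.card_image_le ?_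
    simpa [mul_comm] using hc
  obtain ⟨t, htr, ht⟩ := ht
  rw [Finset.mem_range] at htr
  have ht' : ∀ i s, s < c → (x i + s) % r ≠ t := by
    intro i s hs he
    exact ht (Finset.mem_image.2 ⟨(i, ⟨s, hs⟩), Finset.mem_univ _, he⟩)
  have modc : ∀ a, a < 2 * r → a % r = if a < r then a else a - r := by
    intro a ha
    split_ifs with h1
    · exact Nat.mod_eq_of_lt h1
    · rw [Nat.mod_eq_sub_mod (by omega), Nat.mod_eq_of_lt (by omega)]
  have : Nonempty (Fin h) := ⟨⟨0, hh⟩⟩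
  obtain ⟨j, hj⟩ := Finite.exists_min (fun i => (t + r - x i) % r)
  refine ⟨r - 1 - x j, fun i => ⟨hcc.trans ?_, Nat.mod_lt _ hr⟩, j, ?_⟩
  · norm_cast
    by_contra hlt'
    have hxi := hlt i
    have hxj := hlt j
    have hm := hj i
    have hd := ht' j ((t + r - x j) % r)
    have hb := Nat.mod_lt (t + r - x j) hr
    rw [modc (x j + _) (by omega)] at hd
    rw [modc (t + r - x j) (by omega)] at hd hm
    rw [modc (t + r - x i) (by omega)] at hm
    rw [modc _ (by omega)] at hlt'
    split_ifs at * <;> omega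
  · have hxj := hlt j
    rw [show x j + (r - 1 - x j) = r - 1 by omega]
    exact Nat.mod_eq_of_lt (by omega)
end

section
/- Let n, r1, r2, m be positive natural numbers with n = r1 · r2, gcd(r1, r2) = 1 and r1, r2 > 1, and let λ0 be a positive natural number with m < ⌈r1/λ0⌉. Let φ : ℤ/nℤ → ℤ/r1ℤ × ℤ/r2ℤ be a group isomorphism, and let Γ = {(i1, i2) ∈ ℤ/r1ℤ × ℤ/r2ℤ : the canonical representative of i1 is < m and i2 = 0}. Then for every subset B of ℤ/nℤ with |B| = (λ0 + 1)·r2 − 1, there exists k ∈ ℤ/nℤ such that for all b ∈ B, φ(b + k) ∉ Γ. (This is the combinatorial content of the statement that the cyclic group generated by the shift T_α is an s-PD-like set for s = (λ0+1)·r2 − 1.) -/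
theorem stmt_5 (n r1 r2 m lam0 : ℕ) (hn : 0 < n) (hm : 0 < m)
    (hfac : n = r1 * r2) (hcop : Nat.Coprime r1 r2) (hr1 : 1 < r1) (hr2 : 1 < r2)
    (hlam0 : 0 < lam0) (hceil : (m : ℤ) < ⌈(r1 : ℚ) / lam0⌉)
    (φ : ZMod n ≃+ ZMod r1 × ZMod r2)
    (Γ : Set (ZMod r1 × ZMod r2))
    (hΓ : Γ = {p : ZMod r1 × ZMod r2 | p.1.val < m ∧ p.2 = 0}) :
    ∀ B : Finset (ZMod n), B.card = (lam0 + 1) * r2 - 1 →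
      ∃ k : ZMod n, ∀ b ∈ B, φ (b + k) ∉ Γ := by
  intro B hB
  haveI : NeZero r1 := ⟨by omega⟩
  haveI : NeZero r2 := ⟨by omega⟩
  have hlt : lam0 * m < r1 := by
    have h := Int.lt_ceil.mp hceil
    have hl : (0 : ℚ) < lam0 := by exact_mod_cast hlam0
    rw [lt_div_iff₀ hl] at h
    have h2 : m * lam0 < r1 := by exact_mod_cast h
    rwa [mul_comm]
  obtain ⟨c, -, hc⟩ : ∃ c ∈ (Finset.univ : Finset (ZMod r2)),
      (B.filter (fun b => (φ b).2 = c)).card < lam0 + 1 := by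
    apply Finset.exists_card_fiber_lt_of_card_lt_mul
    rw [hB, Finset.card_univ, ZMod.card, mul_comm r2]
    have : 0 < (lam0 + 1) * r2 := by positivity
    omega
  set F := B.filter (fun b => (φ b).2 = c) with hF
  let bad : Finset (ZMod r1) :=
    (F ×ˢ Finset.range m).image (fun p => (p.2 : ZMod r1) - (φ p.1).1)
  have hbad : bad.card < Fintype.card (ZMod r1) := by
    calc bad.card ≤ (F ×ˢ Finset.range m).card := Finset.card_image_le
      _ = F.card * m := by rw [Finset.card_product, Finset.card_range]
      _ ≤ lam0 * m := Nat.mul_le_mul_right _ (by omega)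
      _ < _ := by rwa [ZMod.card]
  obtain ⟨x, hx⟩ : ∃ x, x ∉ bad := by
    by_contra! h
    rw [Finset.eq_univ_iff_forall.mpr h, Finset.card_univ] at hbad
    exact lt_irrefl _ hbad
  refine ⟨φ.symm (x, -c), fun b hb hmem => hx ?_⟩
  rw [hΓ, map_add, AddEquiv.apply_symm_apply] at hmem
  obtain ⟨h1, h2⟩ := hmem
  simp only [Prod.fst_add, Prod.snd_add] at h1 h2
  refine Finset.mem_image.mpr ⟨(b, ((φ b).1 + x).val), ?_, ?_⟩
  · rw [Finset.mem_product]
    refine ⟨Finset.mem_filter.mpr ⟨hb, ?_⟩, Finset.mem_range.mpr h1⟩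
    rwa [← sub_eq_add_neg, sub_eq_zero] at h2
  · simp
end

section
/- Let F be a finite field with q elements and let E be a field extension of F of degree m ≥ 1 (so |E| = q^m). Set n = q^m − 1 and suppose n = r1·r2 with gcd(r1, r2) = 1 and r1, r2 > 1. Let α be a generator of the cyclic group Eˣ of nonzero elements of E, let a be the multiplicative order of q modulo r1 (so a divides m), and let φ : ℤ/nℤ → ℤ/r1ℤ × ℤ/r2ℤ be any group isomorphism. Define Γ = {(i1, i2) ∈ ℤ/r1ℤ × ℤ/r2ℤ : the canonical representative of i1 is < a and the canonical representative of i2 is < m/a}, and define I = {0} ∪ {α^i : i ∈ {0,…,n−1} and φ(i) ∈ Γ} ⊆ E. Let C be the set of functions f : E → F of the form f(x) = ℓ(x) + c, where ℓ : E → F is F-linear and c ∈ F (the first-order generalized Reed–Muller code R_q(1,m) of length q^m). Then I has exactly m + 1 elements and the restriction map C → (I → F), f ↦ f|_I, is bijective; that is, I is an information set for R_q(1,m). -/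
theorem aux_info {F E ι : Type*} [Field F] [Field E] [Algebra F E] [Fintype ι]
    (b : Module.Basis ι F E) (I : Set E) (hI : I = {0} ∪ Set.range b)
    (C : Set (E → F))
    (hC : C = {f : E → F | ∃ (ℓ : E →ₗ[F] F) (c : F), ∀ x, f x = ℓ x + c}) :
    I.ncard = Fintype.card ι + 1 ∧
      Function.Bijective (fun f : C => (fun x : I => (f : E → F) (x : E))) := by
  have h0 : (0 : E) ∉ Set.range b := by
    rintro ⟨i, hi⟩
    exact b.ne_zero i hi
  have h0I : (0 : E) ∈ I := by rw [hI]; simp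
  have hbI : ∀ i, b i ∈ I := by intro i; rw [hI]; right; exact ⟨i, rfl⟩
  refine ⟨?_, ?_, ?_⟩
  · rw [hI, Set.singleton_union, Set.ncard_insert_of_notMem h0 (Set.finite_range b),
      Set.ncard_range_of_injective b.injective, Nat.card_eq_fintype_card]
  · rintro ⟨f, hf⟩ ⟨g, hg⟩ h
    rw [hC] at hf hg
    obtain ⟨l, c, hl⟩ := hf
    obtain ⟨l', c', hl'⟩ := hg
    have h' : ∀ x ∈ I, f x = g x := fun x hx => congrFun h ⟨x, hx⟩
    have hc : c = c' := by
      have := h' 0 h0I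
      simpa [hl, hl'] using this
    have hll : l = l' := by
      refine b.ext fun i => ?_
      have := h' _ (hbI i)
      rw [hl, hl', hc] at this
      exact add_right_cancel this
    apply Subtype.ext
    funext x
    change f x = g x
    rw [hl, hl', hc, hll]
  · intro g
    let l : E →ₗ[F] F := b.constr F (fun i => g ⟨b i, hbI i⟩ - g ⟨0, h0I⟩)
    refine ⟨⟨fun x => l x + g ⟨0, h0I⟩, ?_⟩, ?_⟩
    · rw [hC]
      exact ⟨l, _, fun _ => rfl⟩
    · funext ⟨x, hx⟩
      have hx' := hx
      rw [hI] at hx'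
      rcases hx' with hx' | ⟨i, rfl⟩
      · have : x = 0 := hx'
        subst this
        simp
      · change l (b i) + _ = _
        have hli : l (b i) = g ⟨b i, hbI i⟩ - g ⟨0, h0I⟩ := Module.Basis.constr_basis b F _ i
        rw [hli, sub_add_cancel]

theorem aux_deg {F E : Type*} [Field F] [Field E] [Algebra F E] [Fintype F] [Fintype E]
    (β : E) (hβ : β ≠ 0) (r : ℕ) (hr : ∀ k : ℕ, β ^ k = 1 ↔ r ∣ k) :
    Module.finrank F (IntermediateField.adjoin F {β}) = orderOf (Fintype.card F : ZMod r) := by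
  classical
  have key : ∀ k : ℕ, (Fintype.card F : ZMod r) ^ k = 1 ↔ β ^ (Fintype.card F ^ k) = β := by
    intro k
    have hpos : 1 ≤ Fintype.card F ^ k := Nat.one_le_pow _ _ Fintype.card_pos
    have e1 : (Fintype.card F : ZMod r) ^ k = 1 ↔ r ∣ Fintype.card F ^ k - 1 := by
      rw [← ZMod.natCast_eq_zero_iff, Nat.cast_sub hpos, sub_eq_zero]
      push_cast
      rfl
    rw [e1, ← hr]
    obtain ⟨t, ht⟩ := Nat.exists_eq_add_of_le hpos
    rw [ht, Nat.add_sub_cancel_left, pow_add, pow_one]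
    constructor
    · intro h; rw [h, mul_one]
    · intro h; exact mul_left_cancel₀ hβ (by rw [h, mul_one])
  have hfin : Finite E := inferInstance
  haveI : Module.Finite F E := Module.Finite.of_finite
  let K := IntermediateField.adjoin F {β}
  haveI : Fintype K := Fintype.ofFinite K
  have hcard : Fintype.card K = Fintype.card F ^ Module.finrank F K := Module.card_eq_pow_finrank
  have hβK : β ∈ K := IntermediateField.mem_adjoin_simple_self F β
  have h1F : 1 < Fintype.card F := Fintype.one_lt_card
  apply Nat.le_antisymm
  · set a := orderOf (Fintype.card F : ZMod r) with ha
    have hd : (Fintype.card F : ZMod r) ^ Module.finrank F K = 1 := by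
      rw [key, ← hcard]
      exact congrArg Subtype.val (FiniteField.pow_card (⟨β, hβK⟩ : K))
    have hapos : 0 < a := orderOf_pos_iff.2 (isOfFinOrder_iff_pow_eq_one.2 ⟨_, Module.finrank_pos, hd⟩)
    have hfix : β ^ (Fintype.card F ^ a) = β := (key a).1 (pow_orderOf_eq_one _)
    let σ : E →ₐ[F] E := (FiniteField.frobeniusAlgHom F E) ^ a
    have hσ : ∀ x, σ x = x ^ (Fintype.card F ^ a) := by
      intro x
      have hit : ∀ k : ℕ, ((FiniteField.frobeniusAlgHom F E) ^ k) x = x ^ (Fintype.card F ^ k) := by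
        intro k
        induction k with
        | zero => simp
        | succ k ih =>
          rw [pow_succ', AlgHom.mul_apply, ih]
          change (x ^ (Fintype.card F ^ k)) ^ Fintype.card F = _
          rw [← pow_mul, pow_succ]
      exact hit a
    have hK : ∀ x ∈ K, x ^ (Fintype.card F ^ a) = x := by
      have : K ≤ IntermediateField.mk (AlgHom.equalizer σ (AlgHom.id F E)) (by
          intro x hx
          have hx' : σ x = x := hx
          change σ x⁻¹ = x⁻¹
          rw [map_inv₀, hx']) := by
        rw [IntermediateField.adjoin_simple_le_iff]
        change σ β = β
        rw [hσ, hfix]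
      intro x hx
      have h2 : σ x = x := this hx
      rw [← hσ, h2]
    have h1 : 1 < Fintype.card F ^ a := Nat.one_lt_pow hapos.ne' h1F
    have hle : Fintype.card K ≤ Fintype.card F ^ a := by
      have hne := FiniteField.X_pow_card_sub_X_ne_zero K h1
      have hnd := FiniteField.X_pow_card_sub_X_natDegree_eq K h1
      have hs : (Finset.univ : Finset K).val ⊆ (Polynomial.X ^ (Fintype.card F ^ a) - Polynomial.X : Polynomial K).roots := by
        intro x _
        rw [Polynomial.mem_roots hne]
        have := hK x x.2
        simp only [Polynomial.IsRoot, Polynomial.eval_sub, Polynomial.eval_pow, Polynomial.eval_X]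
        rw [sub_eq_zero]
        exact Subtype.ext this
      have := Polynomial.card_le_degree_of_subset_roots hs
      rw [hnd] at this
      exact this
    rw [hcard] at hle
    exact (Nat.pow_le_pow_iff_right h1F).1 hle
  · apply Nat.le_of_dvd Module.finrank_pos
    apply orderOf_dvd_of_pow_eq_one
    rw [key, ← hcard]
    exact congrArg Subtype.val (FiniteField.pow_card (⟨β, hβK⟩ : K))

theorem aux_basis {F E : Type*} [Field F] [Field E] [Algebra F E] [Module.Finite F E]
    (β γ : E) (a d : ℕ) (ha : Module.finrank F (IntermediateField.adjoin F {β}) = a)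
    (hd : d = Module.finrank F E / a)
    (hgen : ∀ K : IntermediateField F E, β ∈ K → γ ∈ K → K = ⊤) :
    ∃ b : Module.Basis (Fin a × Fin d) F E, ∀ p, b p = β ^ (p.1 : ℕ) * γ ^ (p.2 : ℕ) := by
  let K := IntermediateField.adjoin F {β}
  haveI : Module.Finite K E := Module.Finite.of_restrictScalars_finite F K E
  have hmul : Module.finrank F K * Module.finrank K E = Module.finrank F E :=
    Module.finrank_mul_finrank F K E
  have hK : a * Module.finrank K E = Module.finrank F E := by rw [← ha]; exact hmul
  have hapos : 0 < a := by rw [← ha]; exact Module.finrank_pos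
  have hdK : d = Module.finrank K E := by
    rw [hd, ← hK, Nat.mul_div_cancel_left _ hapos]
  have htop : IntermediateField.adjoin K {γ} = ⊤ := by
    have h := hgen ((IntermediateField.adjoin K {γ}).restrictScalars F)
      (by
        rw [IntermediateField.mem_restrictScalars]
        exact (IntermediateField.adjoin K {γ}).algebraMap_mem
          (⟨β, IntermediateField.mem_adjoin_simple_self F β⟩ : K))
      (by
        rw [IntermediateField.mem_restrictScalars]
        exact IntermediateField.mem_adjoin_simple_self K γ)
    exact IntermediateField.restrictScalars_eq_top_iff.1 h
  have hγd : (minpoly K γ).natDegree = d := by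
    rw [hdK, ← IntermediateField.adjoin.finrank (Algebra.IsIntegral.isIntegral γ), htop,
      IntermediateField.finrank_top']
  have hβd : (minpoly F (⟨β, IntermediateField.mem_adjoin_simple_self F β⟩ : K)).natDegree = a := by
    rw [← ha, IntermediateField.adjoin.finrank (Algebra.IsIntegral.isIntegral β)]
    rw [← minpoly.algebraMap_eq (B := K) (B' := E) Subtype.val_injective]
    rfl
  have li1 := linearIndependent_pow (K := F) (⟨β, IntermediateField.mem_adjoin_simple_self F β⟩ : K)
  have li2 := linearIndependent_pow (K := K) γ
  rw [hβd] at li1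
  rw [hγd] at li2
  have li := linearIndependent_smul li1 li2
  have hne : Nonempty (Fin a × Fin d) := ⟨⟨⟨0, hapos⟩, ⟨0, by rw [hdK]; exact Module.finrank_pos⟩⟩⟩
  refine ⟨basisOfLinearIndependentOfCardEqFinrank li ?_, ?_⟩
  · simp [hdK, hK]
  · intro p
    rw [coe_basisOfLinearIndependentOfCardEqFinrank]
    rfl

theorem stmt_16 (F E : Type*) [Field F] [Field E] [Algebra F E] [Fintype F] [Fintype E]
    (q m n r1 r2 a : ℕ)
    (hq : q = Fintype.card F)
    (hm : m = Module.finrank F E) (hm1 : 1 ≤ m)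
    (hn : n = q ^ m - 1)
    (hfac : n = r1 * r2) (hcop : Nat.Coprime r1 r2) (hr1 : 1 < r1) (hr2 : 1 < r2)
    (α : Eˣ) (hα : ∀ u : Eˣ, u ∈ Subgroup.zpowers α)
    (ha : a = orderOf (q : ZMod r1))
    (φ : ZMod n ≃+ ZMod r1 × ZMod r2)
    (Γ : Set (ZMod r1 × ZMod r2))
    (hΓ : Γ = {p : ZMod r1 × ZMod r2 | p.1.val < a ∧ p.2.val < m / a})
    (I : Set E)
    (hI : I = {0} ∪ {x : E | ∃ i : ℕ, i < n ∧ φ (i : ZMod n) ∈ Γ ∧ x = (α : E) ^ i})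
    (C : Set (E → F))
    (hC : C = {f : E → F | ∃ (ℓ : E →ₗ[F] F) (c : F), ∀ x, f x = ℓ x + c}) :
    I.ncard = m + 1 ∧
      Function.Bijective (fun f : C => (fun x : I => (f : E → F) (x : E))) := by
  classical
  have hn0 : 0 < n := by rw [hfac]; positivity
  haveI : NeZero n := ⟨hn0.ne'⟩
  haveI : NeZero r1 := ⟨by omega⟩
  haveI : NeZero r2 := ⟨by omega⟩
  haveI : Module.Finite F E := Module.Finite.of_finite
  have hord : orderOf α = n := by
    rw [orderOf_eq_card_of_forall_mem_zpowers hα, Nat.card_eq_fintype_card, Fintype.card_units,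
      hn, hq, hm, Module.card_eq_pow_finrank (K := F) (V := E)]
  have hpow : ∀ i j : ℕ, (α : E) ^ i = (α : E) ^ j ↔ (i : ZMod n) = (j : ZMod n) := by
    intro i j
    rw [ZMod.natCast_eq_natCast_iff, ← hord, ← pow_eq_pow_iff_modEq, Units.ext_iff]
    simp
  obtain ⟨s, hs⟩ : ∃ s : ℕ, φ (s : ZMod n) = (1, 0) :=
    ⟨(φ.symm (1, 0)).val, by rw [ZMod.natCast_zmod_val]; simp⟩
  obtain ⟨t, ht⟩ : ∃ t : ℕ, φ (t : ZMod n) = (0, 1) :=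
    ⟨(φ.symm (0, 1)).val, by rw [ZMod.natCast_zmod_val]; simp⟩
  have hφ : ∀ i j : ℕ, φ ((s * i + t * j : ℕ) : ZMod n) = ((i : ZMod r1), (j : ZMod r2)) := by
    intro i j
    have : ((s * i + t * j : ℕ) : ZMod n) = i • (s : ZMod n) + j • (t : ZMod n) := by
      push_cast
      simp only [nsmul_eq_mul]
      ring
    rw [this, map_add, map_nsmul, map_nsmul, hs, ht]
    simp
  have hmain : ∀ i j k : ℕ, (α : E) ^ k = ((α : E) ^ s) ^ i * ((α : E) ^ t) ^ j ↔
      φ (k : ZMod n) = ((i : ZMod r1), (j : ZMod r2)) := by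
    intro i j k
    rw [← pow_mul, ← pow_mul, ← pow_add, hpow, ← hφ, φ.injective.eq_iff]
  have hβ1 : ∀ k : ℕ, ((α : E) ^ s) ^ k = 1 ↔ r1 ∣ k := by
    intro k
    have := hmain k 0 0
    simp only [pow_zero, mul_one, Nat.cast_zero, map_zero] at this
    rw [eq_comm, this, ← ZMod.natCast_eq_zero_iff, eq_comm, Prod.ext_iff]
    simp
  have hγ1 : ∀ k : ℕ, ((α : E) ^ t) ^ k = 1 ↔ r2 ∣ k := by
    intro k
    have := hmain 0 k 0
    simp only [pow_zero, one_mul, Nat.cast_zero, map_zero] at this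
    rw [eq_comm, this, ← ZMod.natCast_eq_zero_iff, eq_comm, Prod.ext_iff]
    simp
  have hdeg := aux_deg (F := F) ((α : E) ^ s) (pow_ne_zero _ α.ne_zero) r1 hβ1
  rw [← hq, ← ha] at hdeg
  have hgen : ∀ K : IntermediateField F E, (α : E) ^ s ∈ K → (α : E) ^ t ∈ K → K = ⊤ := by
    intro K h1 h2
    have hαK : (α : E) ∈ K := by
      have := (hmain (φ (1 : ℕ)).1.val (φ (1 : ℕ)).2.val 1).2 (by
        rw [ZMod.natCast_zmod_val, ZMod.natCast_zmod_val])
      rw [pow_one] at this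
      rw [this]
      exact K.mul_mem (pow_mem h1 _) (pow_mem h2 _)
    rw [eq_top_iff]
    intro x _
    by_cases hx : x = 0
    · rw [hx]; exact K.zero_mem
    · obtain ⟨z, hz⟩ := hα (Units.mk0 x hx)
      have : x = (α : E) ^ z := by
        have := congrArg Units.val hz
        simpa using this.symm
      rw [this]
      exact zpow_mem hαK z
  obtain ⟨b, hb⟩ := aux_basis ((α : E) ^ s) ((α : E) ^ t) a (m / a) hdeg (by rw [hm]) hgen
  have hcardb : Fintype.card (Fin a × Fin (m / a)) = m := by
    rw [← Module.finrank_eq_card_basis b, ← hm]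
  have hm0 : 0 < a * (m / a) := by
    simp at hcardb; omega
  have hapos : 0 < a := Nat.pos_of_mul_pos_right hm0
  have hdpos : 0 < m / a := Nat.pos_of_mul_pos_left hm0
  have har : a ≤ r1 := by
    by_contra! h
    have := b.injective (a₁ := ⟨⟨r1, h⟩, ⟨0, hdpos⟩⟩) (a₂ := ⟨⟨0, hapos⟩, ⟨0, hdpos⟩⟩) (by
      rw [hb, hb]; simp [(hβ1 r1).2 dvd_rfl])
    simp at this
    omega
  have hdr : m / a ≤ r2 := by
    by_contra! h
    have := b.injective (a₁ := ⟨⟨0, hapos⟩, ⟨r2, h⟩⟩) (a₂ := ⟨⟨0, hapos⟩, ⟨0, hdpos⟩⟩) (by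
      rw [hb, hb]; simp [(hγ1 r2).2 dvd_rfl])
    simp at this
    omega
  have hres := aux_info b I (by
    rw [hI]
    congr 1
    ext x
    constructor
    · rintro ⟨i, _, hi, rfl⟩
      rw [hΓ] at hi
      refine ⟨(⟨_, hi.1⟩, ⟨_, hi.2⟩), ?_⟩
      rw [hb, eq_comm, hmain, ZMod.natCast_zmod_val, ZMod.natCast_zmod_val]
    · rintro ⟨⟨⟨i, hi⟩, ⟨j, hj⟩⟩, rfl⟩
      have hk : φ (((φ.symm ((i : ZMod r1), (j : ZMod r2))).val : ℕ) : ZMod n)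
          = ((i : ZMod r1), (j : ZMod r2)) := by
        rw [ZMod.natCast_zmod_val]; simp
      refine ⟨(φ.symm ((i : ZMod r1), (j : ZMod r2))).val, ZMod.val_lt _, ?_, ?_⟩
      · rw [hk, hΓ]
        change (i : ZMod r1).val < a ∧ (j : ZMod r2).val < m / a
        rw [ZMod.val_cast_of_lt (by omega), ZMod.val_cast_of_lt (by omega)]
        exact ⟨hi, hj⟩
      · rw [hb, eq_comm, hmain, hk]) C hC
  rw [hcardb] at hres
  exact hres
end
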